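/- Let $H \in (0, 1/2)$ and for $T > 0$ define $\tilde{I}_1(T) := \int_{[0,T]^4} e^{-|t_1 - s_1| - |t_2 - s_2|} \, \mathrm{sgn}(t_1 - s_1) \, \mathrm{sgn}(s_2 - t_2) \, H\big(t_2^{2H-1} - \mathrm{sgn}(t_2 - t_1)|t_2 - t_1|^{2H-1}\big) \, H\big(s_1^{2H-1} - \mathrm{sgn}(s_1 - s_2)|s_1 - s_2|^{2H-1}\big) \, dt_1 \, dt_2 \, ds_1 \, ds_2$. Then $\limsup_{T \to \infty} T^{1-2H} \, \Big| \frac{\tilde{I}_1(T)}{2T} - \sigma_H^2 \big( H \Gamma(2H) \big)^2 \Big| < \infty$; in particular $\frac{\tilde{I}_1(T)}{2T\sigma_H^2} \to (H\Gamma(2H))^2$ with speed of convergence at least $T^{2H-1}$. -/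

import Mathlib

open MeasureTheory Real Filter

/-- The exponential average `∫₀ˣ e^{-(x-z)} z^{a-1} dz` of `z^{a-1}` over the past of `x`. -/
noncomputable def expAvgPast (a x : ℝ) : ℝ :=
  exp (-x) * ∫ z in (0:ℝ)..x, exp z * z ^ (a - 1)

/-- The exponential average `∫ₓ^∞ e^{-(z-x)} z^{a-1} dz` of `z^{a-1}` over the future of `x`. -/
noncomputable def expAvgFuture (a x : ℝ) : ℝ :=
  exp x * (Gamma a - ∫ z in (0:ℝ)..x, exp (-z) * z ^ (a - 1))

/-- The convolution of the odd kernels `sgn(x)|x|^{a-1}` and `sgn(x)e^{-|x|}`, at `x ≥ 0`. -/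
noncomputable def oddConv (a x : ℝ) : ℝ :=
  expAvgPast a x - expAvgFuture a x - Gamma a * exp (-x)

section Averages

variable {a : ℝ}

lemma intervalIntegrable_exp_mul_rpow (ha : 0 < a) (p q : ℝ) :
    IntervalIntegrable (fun z : ℝ => exp z * z ^ (a - 1)) volume p q :=
  (intervalIntegral.intervalIntegrable_rpow' (by linarith)).continuousOn_mul
    continuous_exp.continuousOn

lemma intervalIntegrable_exp_neg_mul_rpow (ha : 0 < a) (p q : ℝ) :
    IntervalIntegrable (fun z : ℝ => exp (-z) * z ^ (a - 1)) volume p q :=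
  (intervalIntegral.intervalIntegrable_rpow' (by linarith)).continuousOn_mul
    (by fun_prop)

lemma continuous_expAvgPast (ha : 0 < a) : Continuous (expAvgPast a) := by
  unfold expAvgPast
  have := intervalIntegral.continuous_primitive (intervalIntegrable_exp_mul_rpow ha) 0
  fun_prop

lemma continuous_expAvgFuture (ha : 0 < a) : Continuous (expAvgFuture a) := by
  unfold expAvgFuture
  have := intervalIntegral.continuous_primitive (intervalIntegrable_exp_neg_mul_rpow ha) 0
  fun_prop

lemma continuous_oddConv (ha : 0 < a) : Continuous (oddConv a) := by
  have h1 := continuous_expAvgPast ha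
  have h2 := continuous_expAvgFuture ha
  unfold oddConv
  fun_prop

lemma hasDerivAt_expAvgPast (ha : 0 < a) {x : ℝ} (hx : 0 < x) :
    HasDerivAt (expAvgPast a) (x ^ (a - 1) - expAvgPast a x) x := by
  have hm : Measurable fun z : ℝ => exp z * z ^ (a - 1) := by fun_prop
  have h := intervalIntegral.integral_hasDerivAt_right (intervalIntegrable_exp_mul_rpow ha 0 x)
    hm.stronglyMeasurable.stronglyMeasurableAtFilter
    (continuous_exp.continuousAt.mul (continuousAt_rpow_const x _ (Or.inl hx.ne')))
  convert! ((hasDerivAt_neg x).exp.mul h) using 1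
  have : exp (-x) * exp x = 1 := by rw [← exp_add]; simp
  simp only [expAvgPast]
  linear_combination (-x ^ (a - 1)) * this

lemma hasDerivAt_expAvgFuture (ha : 0 < a) {x : ℝ} (hx : 0 < x) :
    HasDerivAt (expAvgFuture a) (expAvgFuture a x - x ^ (a - 1)) x := by
  have hm : Measurable fun z : ℝ => exp (-z) * z ^ (a - 1) := by fun_prop
  have h := intervalIntegral.integral_hasDerivAt_right (intervalIntegrable_exp_neg_mul_rpow ha 0 x)
    hm.stronglyMeasurable.stronglyMeasurableAtFilter
    (ContinuousAt.mul (by fun_prop) (continuousAt_rpow_const x _ (Or.inl hx.ne')))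
  convert! ((hasDerivAt_exp x).mul (h.const_sub (Gamma a))) using 1
  have : exp x * exp (-x) = 1 := by rw [← exp_add]; simp
  simp only [expAvgFuture]
  linear_combination (x ^ (a - 1)) * this

lemma expAvgFuture_eq_integral (ha : 0 < a) {x : ℝ} (hx : 0 ≤ x) :
    expAvgFuture a x = ∫ r in Set.Ioi (0:ℝ), exp (-r) * (x + r) ^ (a - 1) := by
  have h0 := GammaIntegral_convergent ha
  have h1 := intervalIntegral.integral_Ioi_sub_Ioi (f := fun z : ℝ => exp (-z) * z ^ (a - 1))
    h0 hx
  have h2 := (measurePreserving_add_left volume x).setIntegral_preimage_emb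
    (measurableEmbedding_addLeft x) (fun z => exp (-z) * z ^ (a - 1)) (Set.Ioi x)
  have h3 : (fun r : ℝ => x + r) ⁻¹' Set.Ioi x = Set.Ioi 0 := by ext; simp
  rw [h3] at h2
  rw [expAvgFuture, Gamma_eq_integral ha, ← h1, sub_sub_cancel, ← h2, ← integral_const_mul]
  congr 1; ext r
  rw [← mul_assoc, ← exp_add]
  congr 2; ring

lemma integrableOn_exp_neg_mul_add_rpow (ha : 0 < a) (ha1 : a ≤ 1) {x : ℝ} (hx : 0 ≤ x) :
    IntegrableOn (fun r => exp (-r) * (x + r) ^ (a - 1)) (Set.Ioi (0:ℝ)) := by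
  refine (GammaIntegral_convergent ha).mono' (by fun_prop) ?_
  filter_upwards [ae_restrict_mem measurableSet_Ioi] with r hr
  have hr : 0 < r := hr
  rw [norm_of_nonneg (by positivity)]
  gcongr ?_ * ?_
  exact rpow_le_rpow_of_nonpos hr (by linarith) (by linarith)

lemma expAvgPast_nonneg {x : ℝ} (hx : 0 ≤ x) : 0 ≤ expAvgPast a x :=
  mul_nonneg (exp_pos _).le <| intervalIntegral.integral_nonneg hx fun _ hz =>
    mul_nonneg (exp_pos _).le (rpow_nonneg hz.1 _)

lemma expAvgFuture_nonneg (ha : 0 < a) {x : ℝ} (hx : 0 ≤ x) : 0 ≤ expAvgFuture a x := by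
  rw [expAvgFuture_eq_integral ha hx]
  refine setIntegral_nonneg measurableSet_Ioi fun r hr => ?_
  have hr : 0 < r := hr
  positivity

lemma expAvgFuture_le_Gamma (ha : 0 < a) (ha1 : a ≤ 1) {x : ℝ} (hx : 0 ≤ x) :
    expAvgFuture a x ≤ Gamma a := by
  rw [expAvgFuture_eq_integral ha hx, Gamma_eq_integral ha]
  refine setIntegral_mono_on (integrableOn_exp_neg_mul_add_rpow ha ha1 hx)
    (GammaIntegral_convergent ha) measurableSet_Ioi fun r hr => ?_
  gcongr ?_ * ?_
  exact rpow_le_rpow_of_nonpos hr (by linarith) (by linarith)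

lemma expAvgFuture_le_rpow (ha : 0 < a) (ha1 : a ≤ 1) {x : ℝ} (hx : 0 < x) :
    expAvgFuture a x ≤ x ^ (a - 1) := by
  have e : ∫ r in Set.Ioi (0:ℝ), exp (-r) * x ^ (a - 1) = x ^ (a - 1) := by
    rw [integral_mul_const, integral_exp_neg_Ioi_zero, one_mul]
  rw [expAvgFuture_eq_integral ha hx.le, ← e]
  refine setIntegral_mono_on (integrableOn_exp_neg_mul_add_rpow ha ha1 hx.le)
    ((integrableOn_exp_neg_Ioi 0).mul_const _) measurableSet_Ioi fun r hr => ?_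
  have hr : 0 < r := hr
  gcongr ?_ * ?_
  exact rpow_le_rpow_of_nonpos hx (by linarith) (by linarith)

lemma rpow_sub_inv_le_expAvgFuture (ha : 0 < a) (ha1 : a ≤ 1) {x : ℝ} (hx : 1 ≤ x) :
    x ^ (a - 1) - x⁻¹ ≤ expAvgFuture a x := by
  have hx0 : 0 < x := by linarith
  have hp : x ^ (a - 1) ≤ 1 := rpow_le_one_of_one_le_of_nonpos hx (by linarith)
  have hG : ∫ r in Set.Ioi (0:ℝ), exp (-r) * r = 1 := by
    have := Gamma_eq_integral (s := 2) (by norm_num)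
    rw [Gamma_two] at this
    norm_num at this
    exact this.symm
  have hGi : IntegrableOn (fun r => exp (-r) * r) (Set.Ioi (0:ℝ)) := by
    have := GammaIntegral_convergent (s := 2) (by norm_num)
    norm_num at this
    exact this
  have e1 : ∫ r in Set.Ioi (0:ℝ), (exp (-r) * x ^ (a - 1) - exp (-r) * r * x⁻¹)
      = x ^ (a - 1) - x⁻¹ := by
    rw [integral_sub ((integrableOn_exp_neg_Ioi 0).mul_const _) (hGi.mul_const _),
      integral_mul_const, integral_mul_const, hG, integral_exp_neg_Ioi_zero]
    ring
  rw [expAvgFuture_eq_integral ha hx0.le, ← e1]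
  refine setIntegral_mono_on
    (((integrableOn_exp_neg_Ioi 0).mul_const _).sub (hGi.mul_const _))
    (integrableOn_exp_neg_mul_add_rpow ha ha1 hx0.le) measurableSet_Ioi fun r hr => ?_
  have hr : 0 < r := hr
  have h1 : (x + r) ^ (a - 1) = x ^ (a - 1) * (1 + r / x) ^ (a - 1) := by
    rw [← mul_rpow hx0.le (by positivity)]; congr 1; field_simp
  have h2 : 1 - r / x ≤ (1 + r / x) ^ (a - 1) := by
    have hs : 0 < r / x := by positivity
    calc 1 - r / x ≤ (1 + r / x) ^ (-1 : ℝ) := by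
          rw [rpow_neg_one, ← one_div, le_div_iff₀ (by positivity)]; nlinarith
      _ ≤ _ := rpow_le_rpow_of_exponent_le (by linarith) (by linarith)
  have h3 : x ^ (a - 1) - r * x⁻¹ ≤ (x + r) ^ (a - 1) := by
    rw [h1]
    have : 0 < x ^ (a - 1) := by positivity
    calc x ^ (a - 1) - r * x⁻¹ ≤ x ^ (a - 1) * (1 - r / x) := by
          have : 0 ≤ r * x⁻¹ := by positivity
          rw [div_eq_mul_inv]; nlinarith
      _ ≤ _ := by gcongr
  calc exp (-r) * x ^ (a - 1) - exp (-r) * r * x⁻¹ = exp (-r) * (x ^ (a - 1) - r * x⁻¹) := by ring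
    _ ≤ _ := by gcongr

lemma expAvgPast_le_rpow_div (ha : 0 < a) {x : ℝ} (hx : 0 ≤ x) : expAvgPast a x ≤ x ^ a / a := by
  have e : ∫ z in (0:ℝ)..x, exp x * z ^ (a - 1) = exp x * (x ^ a / a) := by
    rw [intervalIntegral.integral_const_mul, integral_rpow (Or.inl (by linarith))]
    simp [ha.ne']
  have h : ∫ z in (0:ℝ)..x, exp z * z ^ (a - 1) ≤ exp x * (x ^ a / a) := by
    rw [← e]
    refine intervalIntegral.integral_mono_on hx (intervalIntegrable_exp_mul_rpow ha 0 x)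
      ((intervalIntegral.intervalIntegrable_rpow' (by linarith)).const_mul _) fun z hz => ?_
    have := rpow_nonneg hz.1 (a - 1)
    gcongr
    exact hz.2
  calc expAvgPast a x ≤ exp (-x) * (exp x * (x ^ a / a)) := by unfold expAvgPast; gcongr
    _ = x ^ a / a := by rw [← mul_assoc, ← exp_add]; simp

lemma rpow_sub_inv_le_expAvgPast (ha : 0 < a) (ha1 : a ≤ 1) {x : ℝ} (hx : 1 ≤ x) :
    x ^ (a - 1) - x⁻¹ ≤ expAvgPast a x := by
  have hx0 : 0 < x := by linarith
  have hp : x ^ (a - 1) ≤ 1 := rpow_le_one_of_one_le_of_nonpos hx (by linarith)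
  have e : ∫ z in (0:ℝ)..x, exp z * x ^ (a - 1) = (exp x - 1) * x ^ (a - 1) := by
    rw [intervalIntegral.integral_mul_const, integral_exp, exp_zero]
  have h : (exp x - 1) * x ^ (a - 1) ≤ ∫ z in (0:ℝ)..x, exp z * z ^ (a - 1) := by
    rw [← e]
    refine intervalIntegral.integral_mono_on_of_le_Ioo hx0.le
      (Continuous.intervalIntegrable (by fun_prop) _ _)
      (intervalIntegrable_exp_mul_rpow ha 0 x) fun z hz => ?_
    gcongr ?_ * ?_
    exact rpow_le_rpow_of_nonpos hz.1 hz.2.le (by linarith)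
  have h2 : exp (-x) ≤ x⁻¹ := by
    rw [exp_neg]; gcongr; linarith [add_one_le_exp x]
  have h3 : exp (-x) * exp x = 1 := by rw [← exp_add]; simp
  calc x ^ (a - 1) - x⁻¹ ≤ x ^ (a - 1) - exp (-x) * x ^ (a - 1) := by
        have := exp_pos (-x)
        have : exp (-x) * x ^ (a - 1) ≤ exp (-x) * 1 := by gcongr
        linarith
    _ = exp (-x) * ((exp x - 1) * x ^ (a - 1)) := by linear_combination (-x ^ (a - 1)) * h3
    _ ≤ expAvgPast a x := by unfold expAvgPast; gcongr

lemma expAvgPast_le_rpow_add (ha : 0 < a) (ha1 : a < 1) :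
    ∃ K, 0 ≤ K ∧ ∀ x : ℝ, 1 ≤ x → expAvgPast a x ≤ x ^ (a - 1) + K * x⁻¹ := by
  set K : ℝ := max 2 (2 * (2 ^ a / a)) with hK
  have hK2 : 2 ≤ K := le_max_left _ _
  have hsmall : ∀ x : ℝ, 1 ≤ x → x ≤ 2 → expAvgPast a x ≤ x ^ (a - 1) + K * x⁻¹ := by
    intro x h1 h2
    have hx0 : 0 < x := by linarith
    have : K / 2 ≤ K * x⁻¹ := by rw [← div_eq_mul_inv]; gcongr
    have : 2 * (2 ^ a / a) ≤ K := le_max_right _ _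
    have : x ^ a / a ≤ 2 ^ a / a := by gcongr
    have := rpow_pos_of_pos hx0 (a - 1)
    linarith [expAvgPast_le_rpow_div ha hx0.le]
  refine ⟨K, by linarith, fun x hx => ?_⟩
  rcases le_total x 2 with h2 | h2
  · exact hsmall x hx h2
  set N : ℝ → ℝ := fun x => exp x * (x ^ (a - 1) + K * x⁻¹ - expAvgPast a x) with hN
  have hd : ∀ y : ℝ, 0 < y → HasDerivAt N (exp y * (y ^ (a - 1) + K * y⁻¹ - expAvgPast a y) +
      exp y * ((a - 1) * y ^ (a - 1 - 1) + K * (-(y ^ 2)⁻¹) -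
        (y ^ (a - 1) - expAvgPast a y))) y := by
    intro y hy
    exact (hasDerivAt_exp y).mul (((hasDerivAt_rpow_const (Or.inl hy.ne')).add
      ((hasDerivAt_inv hy.ne').const_mul K)).sub (hasDerivAt_expAvgPast ha hy))
  have hmono : MonotoneOn N (Set.Ici 2) := by
    refine monotoneOn_of_deriv_nonneg (convex_Ici 2)
      (fun y hy => (hd y (by linarith [Set.mem_Ici.1 hy])).continuousAt.continuousWithinAt) ?_ ?_
    · intro y hy
      rw [interior_Ici] at hy
      exact (hd y (by linarith [Set.mem_Ioi.1 hy])).differentiableAt.differentiableWithinAt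
    · intro y hy
      rw [interior_Ici] at hy
      have hy : 2 < y := hy
      have hy0 : 0 < y := by linarith
      rw [(hd y hy0).deriv, ← mul_add]
      refine mul_nonneg (exp_pos _).le ?_
      have h1 : y ^ (a - 1 - 1) ≤ y⁻¹ := by
        rw [← rpow_neg_one]; exact rpow_le_rpow_of_exponent_le (by linarith) (by linarith)
      have h2 : (y ^ 2)⁻¹ ≤ y⁻¹ / 2 := by
        rw [pow_two, mul_inv, div_eq_mul_inv]; gcongr
      have h3 : 0 < y⁻¹ := by positivity
      have h4 : 0 ≤ y ^ (a - 1 - 1) := by positivity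
      nlinarith
  have h0 : 0 ≤ N 2 := mul_nonneg (exp_pos _).le (by linarith [hsmall 2 (by norm_num) le_rfl])
  have h1 : 0 ≤ N x := h0.trans (hmono (Set.mem_Ici.2 le_rfl) h2 h2)
  linarith [nonneg_of_mul_nonneg_right h1 (exp_pos x)]

end Averages

section Decay

variable {a : ℝ}

lemma abs_oddConv_le_inv (ha : 0 < a) (ha1 : a < 1) :
    ∃ C, 0 ≤ C ∧ ∀ x : ℝ, 1 ≤ x → |oddConv a x| ≤ C * x⁻¹ := by
  obtain ⟨K, hK, h⟩ := expAvgPast_le_rpow_add ha ha1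
  have hG := Gamma_pos_of_pos ha
  refine ⟨K + 1 + Gamma a, by linarith, fun x hx => ?_⟩
  have hx0 : 0 < x := by linarith
  have h1 := h x hx
  have h2 := rpow_sub_inv_le_expAvgPast ha ha1.le hx
  have h3 := rpow_sub_inv_le_expAvgFuture ha ha1.le hx
  have h4 := expAvgFuture_le_rpow ha ha1.le hx0
  have h5 : exp (-x) ≤ x⁻¹ := by
    rw [exp_neg]; gcongr; linarith [add_one_le_exp x]
  have h6 : Gamma a * exp (-x) ≤ Gamma a * x⁻¹ := by gcongr
  have h7 : 0 ≤ Gamma a * exp (-x) := by positivity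
  have h8 : 0 ≤ K * x⁻¹ := by positivity
  have h9 : 0 < x⁻¹ := by positivity
  have h10 : 0 < Gamma a * x⁻¹ := by positivity
  rw [oddConv, abs_le]
  constructor <;> linarith

lemma abs_oddConv_bounded (ha : 0 < a) (ha1 : a < 1) :
    ∃ C, 0 ≤ C ∧ ∀ x : ℝ, 0 ≤ x → |oddConv a x| ≤ C := by
  obtain ⟨C, hC, h⟩ := abs_oddConv_le_inv ha ha1
  obtain ⟨M, hM⟩ := isCompact_Icc (a := (0:ℝ)) (b := 1) |>.exists_bound_of_continuousOn
    (continuous_oddConv ha).continuousOn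
  refine ⟨max C M, hC.trans (le_max_left _ _), fun x hx => ?_⟩
  rcases le_total x 1 with h1 | h1
  · exact (hM x ⟨hx, h1⟩).trans (le_max_right _ _)
  · refine (h x h1).trans (le_trans ?_ (le_max_left _ _))
    exact mul_le_of_le_one_right hC (inv_le_one_of_one_le₀ h1)

lemma oddConv_sq_le (ha : 0 < a) (ha1 : a < 1) :
    ∃ C, 0 ≤ C ∧ (∀ x : ℝ, 0 < x → oddConv a x ^ 2 ≤ C * x ^ (a - 2)) ∧
      ∀ x : ℝ, 0 ≤ x → oddConv a x ^ 2 ≤ C := by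
  obtain ⟨C, hC, h⟩ := abs_oddConv_le_inv ha ha1
  obtain ⟨M, hM, h'⟩ := abs_oddConv_bounded ha ha1
  have hb : ∀ x : ℝ, 0 ≤ x → oddConv a x ^ 2 ≤ M ^ 2 := fun x hx => by
    rw [← sq_abs]; gcongr; exact h' x hx
  refine ⟨C ^ 2 + M ^ 2, by positivity, fun x hx => ?_, fun x hx => ?_⟩
  · rcases le_total x 1 with h1 | h1
    · have : 1 ≤ x ^ (a - 2) := one_le_rpow_of_pos_of_le_one_of_nonpos hx h1 (by linarith)
      nlinarith [hb x hx.le, sq_nonneg C, sq_nonneg M]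
    · have e : oddConv a x ^ 2 ≤ (C * x⁻¹) ^ 2 := by
        rw [← sq_abs]; gcongr; exact h x h1
      have e2 : (x⁻¹) ^ 2 ≤ x ^ (a - 2) := by
        rw [inv_pow, ← rpow_natCast, ← rpow_neg hx.le]
        exact rpow_le_rpow_of_exponent_le h1 (by norm_num; linarith)
      have : 0 < x ^ (a - 2) := by positivity
      nlinarith [sq_nonneg C, sq_nonneg M, mul_le_mul_of_nonneg_left e2 (sq_nonneg C),
        mul_nonneg (sq_nonneg M) this.le]
  · linarith [hb x hx, sq_nonneg C]

lemma integrableOn_oddConv_sq (ha : 0 < a) (ha1 : a < 1) :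
    IntegrableOn (fun x => oddConv a x ^ 2) (Set.Ioi (0:ℝ)) := by
  obtain ⟨C, -, h, -⟩ := oddConv_sq_le ha ha1
  have hc : Continuous fun x => oddConv a x ^ 2 := (continuous_oddConv ha).pow 2
  rw [← Set.Ioc_union_Ioi_eq_Ioi (zero_le_one' ℝ)]
  refine IntegrableOn.union (hc.integrableOn_Ioc) ?_
  refine ((integrableOn_Ioi_rpow_of_lt (by linarith : a - 2 < -1) one_pos).const_mul C).mono'
    hc.aestronglyMeasurable ?_
  filter_upwards [ae_restrict_mem measurableSet_Ioi] with x hx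
  rw [norm_of_nonneg (sq_nonneg _)]
  exact h x (lt_trans one_pos hx)

/-- The partial integrals of the squared convolution converge at rate `X ^ (a - 1)`. -/
lemma abs_integral_oddConv_sq_sub_le (ha : 0 < a) (ha1 : a < 1) :
    ∃ C, 0 ≤ C ∧ ∀ X : ℝ, 0 < X → |(∫ x in (0:ℝ)..X, oddConv a x ^ 2) -
      ∫ x in Set.Ioi (0:ℝ), oddConv a x ^ 2| ≤ C * X ^ (a - 1) := by
  obtain ⟨C, hC, h, -⟩ := oddConv_sq_le ha ha1
  have h1a : 0 < 1 - a := by linarith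
  refine ⟨C / (1 - a), by positivity, fun X hX => ?_⟩
  rw [← intervalIntegral.integral_Ioi_sub_Ioi (integrableOn_oddConv_sq ha ha1) hX.le,
    sub_sub_cancel_left, abs_neg,
    abs_of_nonneg (setIntegral_nonneg measurableSet_Ioi fun x _ => sq_nonneg _)]
  have e : ∫ x in Set.Ioi X, C * x ^ (a - 2) = C / (1 - a) * X ^ (a - 1) := by
    rw [integral_const_mul, integral_Ioi_rpow_of_lt (by linarith) hX]
    rw [show a - 2 + 1 = -(1 - a) by ring, show a - 1 = -(1 - a) by ring]
    field_simp
  rw [← e]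
  refine setIntegral_mono_on ((integrableOn_oddConv_sq ha ha1).mono_set
    (Set.Ioi_subset_Ioi hX.le)) ((integrableOn_Ioi_rpow_of_lt (by linarith) hX).const_mul C)
    measurableSet_Ioi fun x hx => h x (hX.trans hx)

end Decay

section Evaluation

lemma lintegral_rpow_mul_exp_neg_mul_Ioi {p r : ℝ} (hp : 0 < p) (hr : 0 < r) :
    ∫⁻ t in Set.Ioi (0:ℝ), ENNReal.ofReal (t ^ (p - 1) * exp (-(r * t))) =
      ENNReal.ofReal (r ^ (-p) * Gamma p) := by
  have h := integral_rpow_mul_exp_neg_mul_Ioi hp hr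
  have hpos : 0 < (1 / r) ^ p * Gamma p := by have := Gamma_pos_of_pos hp; positivity
  have hi : IntegrableOn (fun t : ℝ => t ^ (p - 1) * exp (-(r * t))) (Set.Ioi 0) := by
    by_contra hn
    rw [integral_undef hn] at h
    linarith
  rw [← ofReal_integral_eq_lintegral_ofReal hi, h]
  · rw [one_div, inv_rpow hr.le, rpow_neg hr.le]
  · filter_upwards [ae_restrict_mem measurableSet_Ioi] with t ht
    have : (0:ℝ) < t := ht
    positivity

lemma lintegral_rpow_mul_add_rpow {p q r : ℝ} (hp : 0 < p) (hq : 0 < q) (hr : 0 < r) :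
    ∫⁻ x in Set.Ioi (0:ℝ), ENNReal.ofReal (x ^ (p - 1) * (x + r) ^ (-(p + q))) =
      ENNReal.ofReal (r ^ (-q) * (Gamma p * Gamma q / Gamma (p + q))) := by
  have hGp := Gamma_pos_of_pos hp
  have hGq := Gamma_pos_of_pos hq
  have hGpq := Gamma_pos_of_pos (add_pos hp hq)
  have e1 : ∀ x ∈ Set.Ioi (0:ℝ), ENNReal.ofReal (x ^ (p - 1) * (x + r) ^ (-(p + q))) =
      ∫⁻ t in Set.Ioi (0:ℝ), ENNReal.ofReal ((Gamma (p + q))⁻¹ * x ^ (p - 1) *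
        (t ^ (p + q - 1) * exp (-((x + r) * t)))) := by
    intro x hx
    have hx : 0 < x := hx
    simp_rw [ENNReal.ofReal_mul (show 0 ≤ (Gamma (p + q))⁻¹ * x ^ (p - 1) by positivity)]
    rw [lintegral_const_mul _ (by fun_prop),
      lintegral_rpow_mul_exp_neg_mul_Ioi (add_pos hp hq) (by positivity),
      ← ENNReal.ofReal_mul (by positivity)]
    congr 1
    field_simp
  rw [setLIntegral_congr_fun measurableSet_Ioi e1, lintegral_lintegral_swap
    (by apply Measurable.aemeasurable; unfold Function.uncurry; fun_prop)]
  have e2 : ∀ t ∈ Set.Ioi (0:ℝ), ∫⁻ x in Set.Ioi (0:ℝ),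
      ENNReal.ofReal ((Gamma (p + q))⁻¹ * x ^ (p - 1) *
        (t ^ (p + q - 1) * exp (-((x + r) * t)))) =
      ENNReal.ofReal (Gamma p / Gamma (p + q)) *
        ENNReal.ofReal (t ^ (q - 1) * exp (-(r * t))) := by
    intro t ht
    have ht : 0 < t := ht
    have : ∀ x : ℝ, ENNReal.ofReal ((Gamma (p + q))⁻¹ * x ^ (p - 1) *
        (t ^ (p + q - 1) * exp (-((x + r) * t)))) =
        ENNReal.ofReal ((Gamma (p + q))⁻¹ * t ^ (p + q - 1) * exp (-(r * t))) *
        ENNReal.ofReal (x ^ (p - 1) * exp (-(t * x))) := by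
      intro x
      rw [← ENNReal.ofReal_mul (by positivity)]
      congr 1
      rw [show -((x + r) * t) = -(t * x) + -(r * t) by ring, exp_add]
      ring
    simp_rw [this]
    rw [lintegral_const_mul _ (by fun_prop), lintegral_rpow_mul_exp_neg_mul_Ioi hp ht,
      ← ENNReal.ofReal_mul (by positivity), ← ENNReal.ofReal_mul (by positivity)]
    congr 1
    rw [show q - 1 = (p + q - 1) + (-p) by ring, rpow_add ht]
    ring
  rw [setLIntegral_congr_fun measurableSet_Ioi e2, lintegral_const_mul _ (by fun_prop),
    lintegral_rpow_mul_exp_neg_mul_Ioi hq hr, ← ENNReal.ofReal_mul (by positivity)]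
  congr 1
  ring

variable {a : ℝ}

lemma integrableOn_exp_neg_mul_id_mul_add_rpow (ha : 0 < a) (ha1 : a ≤ 1) {x : ℝ} (hx : 0 ≤ x) :
    IntegrableOn (fun r => exp (-r) * (r * (x + r) ^ (a - 2))) (Set.Ioi (0:ℝ)) := by
  refine (GammaIntegral_convergent ha).mono' (by fun_prop) ?_
  filter_upwards [ae_restrict_mem measurableSet_Ioi] with r hr
  have hr : 0 < r := hr
  rw [norm_of_nonneg (by positivity)]
  gcongr ?_ * ?_
  calc r * (x + r) ^ (a - 2) ≤ r * r ^ (a - 2) := by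
        gcongr r * ?_
        exact rpow_le_rpow_of_nonpos hr (by linarith) (by linarith)
    _ = r ^ (a - 1) := by
        rw [show a - 1 = 1 + (a - 2) by ring, rpow_add hr, rpow_one]

lemma integral_exp_neg_mul_id_mul_add_rpow (ha : 0 < a) (ha1 : a ≤ 1) {x : ℝ} (hx : 0 < x) :
    (1 - a) * ∫ r in Set.Ioi (0:ℝ), exp (-r) * (r * (x + r) ^ (a - 2)) =
      (1 - a) * expAvgFuture a x + x * (expAvgFuture a x - x ^ (a - 1)) := by
  have i1 := integrableOn_exp_neg_mul_add_rpow ha ha1 hx.le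
  have i2 := integrableOn_exp_neg_mul_id_mul_add_rpow ha ha1 hx.le
  have hcts : ContinuousAt (fun r : ℝ => -(x * (exp (-r) * (x + r) ^ (a - 1)))) 0 := by
    refine ((ContinuousAt.mul (by fun_prop) ?_).const_mul x).neg
    exact ContinuousAt.rpow_const (by fun_prop) (Or.inl (by simpa using hx.ne'))
  have key := integral_Ioi_of_hasDerivAt_of_tendsto (a := (0:ℝ)) (m := 0)
    (f := fun r : ℝ => -(x * (exp (-r) * (x + r) ^ (a - 1))))
    (f' := fun r => (1 - a + x) * (exp (-r) * (x + r) ^ (a - 1)) -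
      (1 - a) * (exp (-r) * (r * (x + r) ^ (a - 2))))
    hcts.continuousWithinAt ?_ ((i1.const_mul _).sub (i2.const_mul _)) ?_
  · rw [integral_sub (i1.const_mul _) (i2.const_mul _), integral_const_mul, integral_const_mul,
      ← expAvgFuture_eq_integral ha hx.le] at key
    simp only [neg_zero, exp_zero, add_zero, one_mul] at key
    linarith
  · intro r hr
    have hr : 0 < r := hr
    have hy : 0 < x + r := by positivity
    have h1 : HasDerivAt (fun r : ℝ => (x + r) ^ (a - 1))
        (1 * (a - 1) * (x + r) ^ (a - 1 - 1)) r :=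
      ((hasDerivAt_id r).const_add x).rpow_const (Or.inl hy.ne')
    convert! (((hasDerivAt_neg r).exp.mul h1).const_mul x).neg using 1
    have e : (x + r) ^ (a - 1) = (x + r) * (x + r) ^ (a - 2) := by
      rw [show a - 1 = 1 + (a - 2) by ring, rpow_add hy, rpow_one]
    rw [show a - 1 - 1 = a - 2 by ring, e]
    ring
  · have : Tendsto (fun r : ℝ => -(x * (exp (-r) * x ^ (a - 1)))) atTop (nhds 0) := by
      simpa using ((tendsto_exp_neg_atTop_nhds_zero.mul_const (x ^ (a - 1))).const_mul x).neg
    refine squeeze_zero_norm' ?_ (by simpa using this.neg)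
    filter_upwards [eventually_gt_atTop 0] with r hr
    rw [norm_neg, norm_of_nonneg (by positivity)]
    gcongr x * (_ * ?_)
    exact rpow_le_rpow_of_nonpos hx (by linarith) (by linarith)

/-- The weight whose integral gives the non-elementary part of `∫ oddConv a ^ 2`. -/
lemma lintegral_rpow_mul_expAvgFuture_part (ha : 0 < a) (ha1 : a < 1) :
    ∫⁻ x in Set.Ioi (0:ℝ), ENNReal.ofReal (x ^ (a - 1) *
      ((1 - a) * expAvgFuture a x + x * (expAvgFuture a x - x ^ (a - 1)))) =
      ENNReal.ofReal ((1 - a) * (Gamma (2 * a) *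
        (Gamma a * Gamma (2 - 2 * a) / Gamma (2 - a)))) := by
  have hGa := Gamma_pos_of_pos ha
  have hG2 := Gamma_pos_of_pos (show 0 < 2 - 2 * a by linarith)
  have hG3 := Gamma_pos_of_pos (show 0 < 2 - a by linarith)
  have h1a : 0 < 1 - a := by linarith
  have e1 : ∀ x ∈ Set.Ioi (0:ℝ), ENNReal.ofReal (x ^ (a - 1) *
      ((1 - a) * expAvgFuture a x + x * (expAvgFuture a x - x ^ (a - 1)))) =
      ∫⁻ r in Set.Ioi (0:ℝ), ENNReal.ofReal (x ^ (a - 1) * ((1 - a) *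
        (exp (-r) * (r * (x + r) ^ (a - 2))))) := by
    intro x hx
    have hx : 0 < x := hx
    rw [← integral_exp_neg_mul_id_mul_add_rpow ha ha1.le hx, ← integral_const_mul,
      ← integral_const_mul, ofReal_integral_eq_lintegral_ofReal]
    · exact ((integrableOn_exp_neg_mul_id_mul_add_rpow ha ha1.le hx.le).const_mul _).const_mul _
    · filter_upwards [ae_restrict_mem measurableSet_Ioi] with r hr
      have hr : (0:ℝ) < r := hr
      positivity
  rw [setLIntegral_congr_fun measurableSet_Ioi e1, lintegral_lintegral_swap
    (by apply Measurable.aemeasurable; unfold Function.uncurry; fun_prop)]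
  have e2 : ∀ r ∈ Set.Ioi (0:ℝ), ∫⁻ x in Set.Ioi (0:ℝ), ENNReal.ofReal (x ^ (a - 1) * ((1 - a) *
        (exp (-r) * (r * (x + r) ^ (a - 2))))) =
      ENNReal.ofReal ((1 - a) * (Gamma a * Gamma (2 - 2 * a) / Gamma (2 - a))) *
        ENNReal.ofReal (r ^ (2 * a - 1) * exp (-(1 * r))) := by
    intro r hr
    have hr : 0 < r := hr
    have : ∀ x : ℝ, ENNReal.ofReal (x ^ (a - 1) * ((1 - a) *
        (exp (-r) * (r * (x + r) ^ (a - 2))))) = ENNReal.ofReal ((1 - a) * (exp (-r) * r)) *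
        ENNReal.ofReal (x ^ (a - 1) * (x + r) ^ (-(a + (2 - 2 * a)))) := by
      intro x
      rw [← ENNReal.ofReal_mul (by positivity)]
      congr 1
      rw [show -(a + (2 - 2 * a)) = a - 2 by ring]
      ring
    simp_rw [this]
    rw [lintegral_const_mul _ (by fun_prop),
      lintegral_rpow_mul_add_rpow ha (by linarith : 0 < 2 - 2 * a) hr,
      ← ENNReal.ofReal_mul (by positivity), ← ENNReal.ofReal_mul (by positivity)]
    congr 1
    rw [show 2 * a - 1 = 1 + -(2 - 2 * a) by ring, rpow_add hr, rpow_one,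
      show a + (2 - 2 * a) = 2 - a by ring, one_mul]
    ring
  rw [setLIntegral_congr_fun measurableSet_Ioi e2, lintegral_const_mul _ (by fun_prop),
    lintegral_rpow_mul_exp_neg_mul_Ioi (by linarith) one_pos, ← ENNReal.ofReal_mul (by positivity),
    one_rpow]
  congr 1
  ring

lemma expAvgFuture_part_nonneg (ha : 0 < a) (ha1 : a < 1) {x : ℝ} (hx : 0 < x) :
    0 ≤ x ^ (a - 1) * ((1 - a) * expAvgFuture a x + x * (expAvgFuture a x - x ^ (a - 1))) := by
  rw [← integral_exp_neg_mul_id_mul_add_rpow ha ha1.le hx]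
  have : 0 < 1 - a := by linarith
  have : 0 ≤ ∫ r in Set.Ioi (0:ℝ), exp (-r) * (r * (x + r) ^ (a - 2)) := by
    refine setIntegral_nonneg measurableSet_Ioi fun r hr => ?_
    have hr : 0 < r := hr
    positivity
  positivity

lemma integrableOn_expAvgFuture_part (ha : 0 < a) (ha1 : a < 1) :
    IntegrableOn (fun x => x ^ (a - 1) *
      ((1 - a) * expAvgFuture a x + x * (expAvgFuture a x - x ^ (a - 1)))) (Set.Ioi (0:ℝ)) := by
  have hm := (continuous_expAvgFuture ha).measurable
  refine ⟨by fun_prop, ?_⟩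
  rw [hasFiniteIntegral_iff_ofReal, lintegral_rpow_mul_expAvgFuture_part ha ha1]
  · exact ENNReal.ofReal_lt_top
  · filter_upwards [ae_restrict_mem measurableSet_Ioi] with x hx
    exact expAvgFuture_part_nonneg ha ha1 hx

lemma integral_expAvgFuture_part (ha : 0 < a) (ha1 : a < 1) :
    ∫ x in Set.Ioi (0:ℝ), x ^ (a - 1) *
      ((1 - a) * expAvgFuture a x + x * (expAvgFuture a x - x ^ (a - 1))) =
      (1 - a) * (Gamma (2 * a) * (Gamma a * Gamma (2 - 2 * a) / Gamma (2 - a))) := by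
  have hGa := Gamma_pos_of_pos ha
  have hG1 := Gamma_pos_of_pos (show 0 < 2 * a by linarith)
  have hG2 := Gamma_pos_of_pos (show 0 < 2 - 2 * a by linarith)
  have hG3 := Gamma_pos_of_pos (show 0 < 2 - a by linarith)
  have h1a : 0 < 1 - a := by linarith
  rw [integral_eq_lintegral_of_nonneg_ae, lintegral_rpow_mul_expAvgFuture_part ha ha1,
    ENNReal.toReal_ofReal (by positivity)]
  · filter_upwards [ae_restrict_mem measurableSet_Ioi] with x hx
    exact expAvgFuture_part_nonneg ha ha1 hx
  · exact (integrableOn_expAvgFuture_part ha ha1).1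

lemma tendsto_expAvgFuture (ha : 0 < a) (ha1 : a < 1) :
    Tendsto (expAvgFuture a) atTop (nhds 0) := by
  have h := tendsto_rpow_neg_atTop (show 0 < 1 - a by linarith)
  rw [neg_sub] at h
  refine squeeze_zero' ?_ ?_ h
  · filter_upwards [eventually_ge_atTop 0] with x hx using expAvgFuture_nonneg ha hx
  · filter_upwards [eventually_gt_atTop 0] with x hx using expAvgFuture_le_rpow ha ha1.le hx

lemma tendsto_expAvgPast (ha : 0 < a) (ha1 : a < 1) :
    Tendsto (expAvgPast a) atTop (nhds 0) := by
  obtain ⟨K, -, hK⟩ := expAvgPast_le_rpow_add ha ha1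
  have h := (tendsto_rpow_neg_atTop (show 0 < 1 - a by linarith)).add
    (tendsto_inv_atTop_zero.const_mul K)
  rw [neg_sub, mul_zero, add_zero] at h
  refine squeeze_zero' ?_ ?_ h
  · filter_upwards [eventually_ge_atTop 0] with x hx using expAvgPast_nonneg hx
  · filter_upwards [eventually_ge_atTop 1] with x hx using hK x hx

/-- An antiderivative of `oddConv a ^ 2` up to explicitly integrable terms. -/
noncomputable def oddConvSqPrimitive (a x : ℝ) : ℝ :=
  2 * (expAvgPast a x - Gamma a * exp (-x)) * (x ^ a - x * expAvgFuture a x)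
    - ((expAvgPast a x - Gamma a * exp (-x)) ^ 2 - expAvgFuture a x ^ 2) / 2
    - (1 - 2 * a) * (expAvgPast a x * expAvgFuture a x)

lemma hasDerivAt_oddConvSqPrimitive (ha : 0 < a) {x : ℝ} (hx : 0 < x) :
    HasDerivAt (oddConvSqPrimitive a) (oddConv a x ^ 2
      - 2 * (x ^ (a - 1) *
        ((1 - a) * expAvgFuture a x + x * (expAvgFuture a x - x ^ (a - 1))))
      + (1 - 2 * a) * Gamma a * (exp (-x) * x ^ (a - 1))) x := by
  have hψ := hasDerivAt_expAvgPast ha hx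
  have hφ := hasDerivAt_expAvgFuture ha hx
  have hp := hψ.sub ((hasDerivAt_neg x).exp.const_mul (Gamma a))
  have hq := (hasDerivAt_rpow_const (p := a) (Or.inl hx.ne')).sub ((hasDerivAt_id x).mul hφ)
  convert! (((hp.const_mul 2).mul hq).sub (((hp.pow 2).sub (hφ.pow 2)).div_const 2)).sub
    ((hψ.mul hφ).const_mul (1 - 2 * a)) using 1
  have e : x ^ a = x * x ^ (a - 1) := by
    rw [mul_comm, ← rpow_add_one hx.ne', sub_add_cancel]
  simp only [oddConv, Pi.sub_apply, Pi.mul_apply, id, e]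
  push_cast
  ring

lemma tendsto_oddConvSqPrimitive (ha : 0 < a) (ha1 : a < 1) :
    Tendsto (oddConvSqPrimitive a) atTop (nhds 0) := by
  have hφ := tendsto_expAvgFuture ha ha1
  have hψ := tendsto_expAvgPast ha ha1
  have hp : Tendsto (fun x => expAvgPast a x - Gamma a * exp (-x)) atTop (nhds 0) := by
    simpa using hψ.sub (tendsto_exp_neg_atTop_nhds_zero.const_mul (Gamma a))
  have h1 : Tendsto (fun x => 2 * (expAvgPast a x - Gamma a * exp (-x)) *
      (x ^ a - x * expAvgFuture a x)) atTop (nhds 0) := by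
    refine squeeze_zero_norm' (a := fun x => 2 * |expAvgPast a x - Gamma a * exp (-x)|) ?_
      (by simpa using hp.abs.const_mul 2)
    filter_upwards [eventually_ge_atTop 1] with x hx
    have hx0 : 0 < x := by linarith
    have e : x ^ a = x * x ^ (a - 1) := by
      rw [mul_comm, ← rpow_add_one hx0.ne', sub_add_cancel]
    have b : |x ^ a - x * expAvgFuture a x| ≤ 1 := by
      have l1 := expAvgFuture_le_rpow ha ha1.le hx0
      have l2 := rpow_sub_inv_le_expAvgFuture ha ha1.le hx
      rw [e, ← mul_sub, abs_of_nonneg (mul_nonneg hx0.le (by linarith))]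
      calc x * (x ^ (a - 1) - expAvgFuture a x) ≤ x * x⁻¹ := by gcongr; linarith
        _ = 1 := mul_inv_cancel₀ hx0.ne'
    rw [norm_mul, norm_mul, norm_eq_abs, norm_eq_abs, norm_eq_abs, abs_two]
    exact mul_le_of_le_one_right (by positivity) b
  have := (h1.sub (((hp.pow 2).sub (hφ.pow 2)).div_const 2)).sub
    ((hψ.mul hφ).const_mul (1 - 2 * a))
  rwa [show (0:ℝ) - (0 ^ 2 - 0 ^ 2) / 2 - (1 - 2 * a) * (0 * 0) = 0 by ring] at this

/-- The squared `L²` norm of the convolution on the half-line. -/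
lemma integral_oddConv_sq (ha : 0 < a) (ha1 : a < 1) :
    ∫ x in Set.Ioi (0:ℝ), oddConv a x ^ 2 =
      ((2 * a - 1) + 2 * Gamma (2 - 2 * a) * Gamma (2 * a) / (Gamma a * Gamma (1 - a))) *
        Gamma a ^ 2 := by
  have i1 := integrableOn_oddConv_sq ha ha1
  have i2 := (integrableOn_expAvgFuture_part ha ha1).const_mul 2
  have i3 := (GammaIntegral_convergent ha).const_mul ((1 - 2 * a) * Gamma a)
  have hc : Continuous (oddConvSqPrimitive a) := by
    have h1 := continuous_expAvgPast ha
    have h2 := continuous_expAvgFuture ha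
    have h3 := continuous_rpow_const ha.le
    unfold oddConvSqPrimitive
    fun_prop
  have key := integral_Ioi_of_hasDerivAt_of_tendsto hc.continuousWithinAt
    (fun x hx => hasDerivAt_oddConvSqPrimitive ha hx) ((i1.sub i2).add i3)
    (tendsto_oddConvSqPrimitive ha ha1)
  have h0 : oddConvSqPrimitive a 0 = 0 := by
    simp [oddConvSqPrimitive, expAvgPast, expAvgFuture, zero_rpow ha.ne']
  rw [integral_add (by exact i1.sub i2) i3, integral_sub i1 i2, integral_const_mul,
    integral_const_mul,
    integral_expAvgFuture_part ha ha1, ← Gamma_eq_integral ha, h0] at key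
  have h1a : 0 < 1 - a := by linarith
  have hGa := Gamma_pos_of_pos ha
  have hG1 := Gamma_pos_of_pos h1a
  have e : Gamma (2 - a) = (1 - a) * Gamma (1 - a) := by
    rw [← Gamma_add_one h1a.ne']; congr 1; ring
  rw [e] at key
  have key' : ∫ x in Set.Ioi (0:ℝ), oddConv a x ^ 2 = 2 * ((1 - a) * (Gamma (2 * a) *
      (Gamma a * Gamma (2 - 2 * a) / ((1 - a) * Gamma (1 - a))))) -
      (1 - 2 * a) * Gamma a * Gamma a := by linarith
  rw [key']
  field_simp
  ring

end Evaluation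

/-- The odd exponential kernel. -/
noncomputable def expKer (x : ℝ) : ℝ := exp (-|x|) * Real.sign x

/-- The odd power kernel. -/
noncomputable def powKer (a x : ℝ) : ℝ := Real.sign x * |x| ^ (a - 1)

section Kernels

variable {a : ℝ}

lemma measurable_real_sign : Measurable Real.sign := by
  unfold Real.sign
  exact Measurable.ite measurableSet_Iio measurable_const
    (Measurable.ite measurableSet_Ioi measurable_const measurable_const)

lemma measurable_expKer : Measurable expKer := by
  have := measurable_real_sign
  unfold expKer
  fun_prop

lemma measurable_powKer : Measurable (powKer a) := by
  have := measurable_real_sign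
  unfold powKer
  fun_prop

lemma abs_real_sign_le_one (x : ℝ) : |Real.sign x| ≤ 1 := by
  rcases Real.sign_apply_eq x with h | h | h <;> simp [h]

lemma abs_expKer_le_one (x : ℝ) : |expKer x| ≤ 1 := by
  rw [expKer, abs_mul, abs_of_pos (exp_pos _)]
  exact mul_le_one₀ (exp_le_one_iff.2 (by simp)) (abs_nonneg _) (abs_real_sign_le_one x)

lemma abs_powKer_le (x : ℝ) : |powKer a x| ≤ |x| ^ (a - 1) := by
  have : 0 ≤ |x| ^ (a - 1) := by positivity
  rw [powKer, abs_mul, abs_of_nonneg this]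
  exact mul_le_of_le_one_left this (abs_real_sign_le_one x)

lemma expKer_neg (x : ℝ) : expKer (-x) = -expKer x := by simp [expKer, Real.sign_neg]

lemma powKer_neg (x : ℝ) : powKer a (-x) = -powKer a x := by simp [powKer, Real.sign_neg]

lemma expKer_of_pos {x : ℝ} (hx : 0 < x) : expKer x = exp (-x) := by
  simp [expKer, Real.sign_of_pos hx, abs_of_pos hx]

lemma expKer_of_neg {x : ℝ} (hx : x < 0) : expKer x = -exp x := by
  simp [expKer, Real.sign_of_neg hx, abs_of_neg hx]

lemma powKer_of_pos {x : ℝ} (hx : 0 < x) : powKer a x = x ^ (a - 1) := by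
  simp [powKer, Real.sign_of_pos hx, abs_of_pos hx]

lemma powKer_of_neg {x : ℝ} (hx : x < 0) : powKer a x = -(-x) ^ (a - 1) := by
  simp [powKer, Real.sign_of_neg hx, abs_of_neg hx]

lemma intervalIntegrable_abs_rpow (ha : 0 < a) (p q : ℝ) :
    IntervalIntegrable (fun x : ℝ => |x| ^ (a - 1)) volume p q := by
  have h : ∀ p q, IntervalIntegrable (fun x : ℝ => x ^ (a - 1)) volume p q := fun p q =>
    intervalIntegral.intervalIntegrable_rpow' (by linarith)
  have h2 : IntervalIntegrable (fun x : ℝ => (-x) ^ (a - 1)) volume p q := by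
    simpa using (h (-p) (-q)).comp_sub_left 0
  have hm : Measurable fun x : ℝ => |x| ^ (a - 1) := by fun_prop
  refine ((h p q).abs.add h2.abs).mono_fun' hm.aestronglyMeasurable
    (Eventually.of_forall fun x => ?_)
  simp only
  rw [norm_of_nonneg (by positivity)]
  rcases le_total 0 x with hx | hx
  · rw [abs_of_nonneg hx]
    linarith [le_abs_self (x ^ (a - 1)), abs_nonneg ((-x) ^ (a - 1))]
  · rw [abs_of_nonpos hx]
    linarith [le_abs_self ((-x) ^ (a - 1)), abs_nonneg (x ^ (a - 1))]

lemma intervalIntegrable_abs_sub_rpow (ha : 0 < a) (u p q : ℝ) :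
    IntervalIntegrable (fun w : ℝ => |u - w| ^ (a - 1)) volume p q := by
  simpa using (intervalIntegrable_abs_rpow ha (u - p) (u - q)).comp_sub_left u

lemma intervalIntegrable_expKer (v p q : ℝ) :
    IntervalIntegrable (fun w => expKer (w - v)) volume p q := by
  have hm : Measurable fun w => expKer (w - v) := measurable_expKer.comp (by fun_prop)
  refine (intervalIntegrable_const (c := (1:ℝ))).mono_fun' hm.aestronglyMeasurable
    (Eventually.of_forall fun x => ?_)
  exact abs_expKer_le_one _

lemma intervalIntegrable_expKer_mul_powKer (ha : 0 < a) (u v p q : ℝ) :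
    IntervalIntegrable (fun w => expKer (w - v) * powKer a (u - w)) volume p q := by
  have h1 := measurable_expKer
  have h2 := measurable_powKer (a := a)
  have hm : Measurable fun w => expKer (w - v) * powKer a (u - w) := by fun_prop
  refine (intervalIntegrable_abs_sub_rpow ha u p q).mono_fun' hm.aestronglyMeasurable
    (Eventually.of_forall fun x => ?_)
  dsimp only
  rw [norm_eq_abs, abs_mul]
  exact (mul_le_of_le_one_left (abs_nonneg _) (abs_expKer_le_one _)).trans (abs_powKer_le _)

lemma integral_expKer {T v : ℝ} (hv : 0 ≤ v) (hvT : v ≤ T) :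
    ∫ w in (0:ℝ)..T, expKer (w - v) = exp (-v) - exp (-(T - v)) := by
  rw [← intervalIntegral.integral_add_adjacent_intervals (intervalIntegrable_expKer v 0 v)
    (intervalIntegrable_expKer v v T)]
  have e1 : ∫ w in (0:ℝ)..v, expKer (w - v) = ∫ w in (0:ℝ)..v, -exp (w - v) :=
    intervalIntegral.integral_congr_Ioo_of_le hv fun w hw => expKer_of_neg (by linarith [hw.2])
  have e2 : ∫ w in v..T, expKer (w - v) = ∫ w in v..T, exp (v - w) :=
    intervalIntegral.integral_congr_Ioo_of_le hvT fun w hw => by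
      rw [expKer_of_pos (by linarith [hw.1]), neg_sub]
  rw [e1, e2, intervalIntegral.integral_neg, intervalIntegral.integral_comp_sub_right (fun x => exp x),
    intervalIntegral.integral_comp_sub_left (fun x => exp x), integral_exp, integral_exp]
  simp only [sub_self, exp_zero, zero_sub, neg_sub]
  ring

lemma integral_expKer_mul_powKer_of_le (ha : 0 < a) {T u v : ℝ} (hu : 0 ≤ u) (huv : u ≤ v)
    (hvT : v ≤ T) :
    ∫ w in (0:ℝ)..T, expKer (w - v) * powKer a (u - w) =
      oddConv a (v - u) + exp (-(T - v)) * expAvgFuture a (T - u) +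
        exp (-v) * expAvgFuture a u := by
  have hi := intervalIntegrable_expKer_mul_powKer ha u v
  rw [← intervalIntegral.integral_add_adjacent_intervals (hi 0 u) (hi u T),
    ← intervalIntegral.integral_add_adjacent_intervals (hi u v) (hi v T)]
  have e1 : ∫ w in (0:ℝ)..u, expKer (w - v) * powKer a (u - w) =
      -exp (u - v) * ∫ y in (0:ℝ)..u, exp (-y) * y ^ (a - 1) := by
    rw [← intervalIntegral.integral_const_mul]
    have := intervalIntegral.integral_comp_sub_left
      (fun y => -exp (u - v) * (exp (-y) * y ^ (a - 1))) u (a := 0) (b := u)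
    rw [sub_self, sub_zero] at this
    rw [← this]
    refine intervalIntegral.integral_congr_Ioo_of_le hu fun w hw => ?_
    rw [expKer_of_neg (by linarith [hw.2]), powKer_of_pos (by linarith [hw.2]), ← mul_assoc,
      neg_mul (exp _) (exp _), ← exp_add]
    congr 3; ring
  have e2 : ∫ w in u..v, expKer (w - v) * powKer a (u - w) = expAvgPast a (v - u) := by
    rw [expAvgPast, ← intervalIntegral.integral_const_mul]
    have := intervalIntegral.integral_comp_sub_right
      (fun z => exp (-(v - u)) * (exp z * z ^ (a - 1))) u (a := u) (b := v)
    rw [sub_self] at this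
    rw [← this]
    refine intervalIntegral.integral_congr_Ioo_of_le huv fun w hw => ?_
    rw [expKer_of_neg (by linarith [hw.2]), powKer_of_neg (by linarith [hw.1]), ← mul_assoc,
      ← exp_add, neg_mul_neg, neg_sub]
    congr 2; ring
  have e3 : ∫ w in v..T, expKer (w - v) * powKer a (u - w) =
      -exp (v - u) * ∫ z in (v - u)..(T - u), exp (-z) * z ^ (a - 1) := by
    rw [← intervalIntegral.integral_const_mul]
    rw [← intervalIntegral.integral_comp_sub_right
      (fun z => -exp (v - u) * (exp (-z) * z ^ (a - 1))) u (a := v) (b := T)]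
    refine intervalIntegral.integral_congr_Ioo_of_le hvT fun w hw => ?_
    rw [expKer_of_pos (by linarith [hw.1]), powKer_of_neg (by linarith [hw.1]), ← mul_assoc,
      neg_mul (exp _) (exp _), ← exp_add, neg_sub, neg_mul, mul_neg, neg_sub]
    congr 3; ring
  have hj := intervalIntegrable_exp_neg_mul_rpow ha
  rw [e1, e2, e3, ← intervalIntegral.integral_interval_sub_left (hj 0 (T - u)) (hj 0 (v - u))]
  simp only [oddConv, expAvgFuture]
  have x1 : exp (-v) * exp u = exp (u - v) := by rw [← exp_add]; congr 1; ring
  have x2 : exp (-(T - v)) * exp (T - u) = exp (v - u) := by rw [← exp_add]; congr 1; ring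
  have x3 : exp (-(v - u)) = exp (u - v) := by rw [neg_sub]
  rw [x3, ← mul_assoc, ← mul_assoc, x1, x2]
  ring

lemma integral_expKer_mul_powKer (ha : 0 < a) {T u v : ℝ} (hu : u ∈ Set.Icc 0 T)
    (hv : v ∈ Set.Icc 0 T) :
    ∫ w in (0:ℝ)..T, expKer (w - v) * powKer a (u - w) =
      oddConv a |u - v| + exp (-(T - v)) * expAvgFuture a (T - u) +
        exp (-v) * expAvgFuture a u := by
  rcases le_total u v with h | h
  · rw [integral_expKer_mul_powKer_of_le ha hu.1 h hv.2, abs_sub_comm,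
      abs_of_nonneg (sub_nonneg.2 h)]
  · have := integral_expKer_mul_powKer_of_le ha (T := T) (u := T - u) (v := T - v)
      (by linarith [hu.2]) (by linarith) (by linarith [hv.1])
    have hs := intervalIntegral.integral_comp_sub_left
      (fun w => expKer (w - (T - v)) * powKer a (T - u - w)) T (a := 0) (b := T)
    rw [sub_self, sub_zero] at hs
    rw [← hs] at this
    rw [abs_of_nonneg (sub_nonneg.2 h)]
    have e : ∀ w, expKer (T - w - (T - v)) * powKer a (T - u - (T - w)) =
        expKer (w - v) * powKer a (u - w) := fun w => by
      rw [show T - w - (T - v) = -(w - v) by ring, show T - u - (T - w) = -(u - w) by ring,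
        expKer_neg, powKer_neg, neg_mul_neg]
    simp_rw [e, sub_sub_cancel] at this
    rw [this, show T - v - (T - u) = u - v by ring]
    ring

/-- The integral of the two kernels along the middle vertex, on `[0, T]`. -/
noncomputable def kernelChain (a T u v : ℝ) : ℝ :=
  ∫ w in (0:ℝ)..T, expKer (w - v) * (u ^ (a - 1) - powKer a (u - w))

lemma kernelChain_eq (ha : 0 < a) {T u v : ℝ} (hu : u ∈ Set.Icc 0 T) (hv : v ∈ Set.Icc 0 T) :
    kernelChain a T u v = u ^ (a - 1) * (exp (-v) - exp (-(T - v))) -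
      (oddConv a |u - v| + exp (-(T - v)) * expAvgFuture a (T - u) +
        exp (-v) * expAvgFuture a u) := by
  rw [← integral_expKer_mul_powKer ha hu hv, ← integral_expKer hv.1 hv.2,
    ← intervalIntegral.integral_const_mul, ← intervalIntegral.integral_sub
      ((intervalIntegrable_expKer v 0 T).const_mul _)
      (intervalIntegrable_expKer_mul_powKer ha u v 0 T), kernelChain]
  congr 1; ext w; ring

end Kernels

section Fubini

variable {a T : ℝ}

lemma integrable_prod_abs_sub_rpow (ha : 0 < a) (hT : 0 ≤ T) :
    Integrable (fun p : ℝ × ℝ => |p.1 - p.2| ^ (a - 1))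
      ((volume.restrict (Set.Ioc 0 T)).prod (volume.restrict (Set.Ioc 0 T))) := by
  have hh : Integrable ((Set.Ioc (-T) T).indicator fun x : ℝ => |x| ^ (a - 1)) volume := by
    rw [integrable_indicator_iff measurableSet_Ioc]
    exact (intervalIntegrable_iff_integrableOn_Ioc_of_le (by linarith)).1
      (intervalIntegrable_abs_rpow ha (-T) T)
  have h1 : Integrable (fun _ : ℝ => (1:ℝ)) (volume.restrict (Set.Ioc 0 T)) :=
    integrable_const _
  have := (h1.convolution_integrand (ContinuousLinearMap.mul ℝ ℝ) hh).mono_measure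
    (Measure.prod_mono (Measure.restrict_le_self (s := Set.Ioc 0 T)) le_rfl)
  refine this.congr ?_
  rw [Measure.prod_restrict]
  filter_upwards [ae_restrict_mem (measurableSet_Ioc.prod measurableSet_Ioc)] with p hp
  obtain ⟨⟨h1, h2⟩, h3, h4⟩ := hp
  have : p.1 - p.2 ∈ Set.Ioc (-T) T := ⟨by linarith, by linarith⟩
  simp [this]

lemma abs_chain_le (u v w : ℝ) : |expKer (w - v) * (u ^ (a - 1) - powKer a (u - w))| ≤
    |u| ^ (a - 1) + |u - w| ^ (a - 1) := by
  rw [abs_mul]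
  refine (mul_le_of_le_one_left (abs_nonneg _) (abs_expKer_le_one _)).trans ?_
  refine (abs_sub _ _).trans (add_le_add (abs_rpow_le_abs_rpow _ _) (abs_powKer_le _))

lemma measurable_kernelChain (hT : 0 ≤ T) :
    Measurable fun p : ℝ × ℝ => kernelChain a T p.1 p.2 := by
  have h1 := measurable_expKer
  have h2 := measurable_powKer (a := a)
  have : Measurable (fun q : (ℝ × ℝ) × ℝ => expKer (q.2 - q.1.2) *
      (q.1.1 ^ (a - 1) - powKer a (q.1.1 - q.2))) := by fun_prop
  have := (this.stronglyMeasurable.integral_prod_right'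
    (ν := volume.restrict (Set.Ioc 0 T))).measurable
  simpa only [kernelChain, intervalIntegral.integral_of_le hT] using this

lemma integrable_dominating (ha : 0 < a) (hT : 0 ≤ T) :
    Integrable (fun p : ℝ × ℝ => |p.1| ^ (a - 1) + |p.1 - p.2| ^ (a - 1))
      ((volume.restrict (Set.Ioc 0 T)).prod (volume.restrict (Set.Ioc 0 T))) := by
  refine Integrable.add ?_ (integrable_prod_abs_sub_rpow ha hT)
  have : IntegrableOn (fun x : ℝ => |x| ^ (a - 1)) (Set.Ioc 0 T) :=
    (intervalIntegrable_iff_integrableOn_Ioc_of_le hT).1 (intervalIntegrable_abs_rpow ha 0 T)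
  exact Integrable.comp_fst this _

lemma abs_kernelChain_le (ha : 0 < a) (hT : 0 ≤ T) (u v : ℝ) : |kernelChain a T u v| ≤
    ∫ w in Set.Ioc 0 T, (|u| ^ (a - 1) + |u - w| ^ (a - 1)) := by
  rw [kernelChain, intervalIntegral.integral_of_le hT]
  refine norm_integral_le_of_norm_le
    (f := fun w => expKer (w - v) * (u ^ (a - 1) - powKer a (u - w)))
    (g := fun w => |u| ^ (a - 1) + |u - w| ^ (a - 1)) ?_
    (Eventually.of_forall fun w => abs_chain_le u v w)
  exact (integrable_const _).add <| (intervalIntegrable_iff_integrableOn_Ioc_of_le hT).1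
    (intervalIntegrable_abs_sub_rpow ha u 0 T)

lemma integrable_triple (ha : 0 < a) (hT : 0 ≤ T) :
    Integrable (fun p : ℝ × ℝ × ℝ => expKer (p.1 - p.2.2) *
        (p.2.1 ^ (a - 1) - powKer a (p.2.1 - p.1)) * kernelChain a T p.2.2 p.2.1)
      ((volume.restrict (Set.Ioc 0 T)).prod
        ((volume.restrict (Set.Ioc 0 T)).prod (volume.restrict (Set.Ioc 0 T)))) := by
  have h1 := measurable_expKer
  have h2 := measurable_powKer (a := a)
  have h3 := measurable_kernelChain (a := a) hT
  have h4 : Measurable fun p : ℝ × ℝ × ℝ => kernelChain a T p.2.2 p.2.1 :=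
    h3.comp (by fun_prop : Measurable fun p : ℝ × ℝ × ℝ => (p.2.2, p.2.1))
  have hd := integrable_dominating ha hT
  have hdom := (measurePreserving_prodAssoc (volume.restrict (Set.Ioc 0 T))
    (volume.restrict (Set.Ioc 0 T)) (volume.restrict (Set.Ioc 0 T))).symm
    |>.integrable_comp_of_integrable (hd.swap.mul_prod hd.integral_prod_left)
  refine hdom.mono' (by fun_prop) (Eventually.of_forall fun p => ?_)
  rw [norm_eq_abs, abs_mul]
  have : 0 ≤ |p.2.1| ^ (a - 1) + |p.2.1 - p.1| ^ (a - 1) := by positivity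
  exact mul_le_mul (abs_chain_le _ _ _) (abs_kernelChain_le ha hT _ _) (abs_nonneg _) this

lemma integrable_kernelChain_mul (ha : 0 < a) (hT : 0 ≤ T) :
    Integrable (fun p : ℝ × ℝ => kernelChain a T p.1 p.2 * kernelChain a T p.2 p.1)
      ((volume.restrict (Set.Ioc 0 T)).prod (volume.restrict (Set.Ioc 0 T))) := by
  refine (integrable_triple ha hT).integral_prod_right.congr (Eventually.of_forall fun p => ?_)
  simp only [integral_mul_const, kernelChain, intervalIntegral.integral_of_le hT]

lemma integral_triple_eq (ha : 0 < a) (hT : 0 ≤ T) :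
    ∫ t₁ in (0:ℝ)..T, ∫ t₂ in (0:ℝ)..T, ∫ s₁ in (0:ℝ)..T,
      expKer (t₁ - s₁) * (t₂ ^ (a - 1) - powKer a (t₂ - t₁)) * kernelChain a T s₁ t₂ =
    ∫ p, kernelChain a T p.1 p.2 * kernelChain a T p.2 p.1
      ∂((volume.restrict (Set.Ioc 0 T)).prod (volume.restrict (Set.Ioc 0 T))) := by
  simp only [intervalIntegral.integral_of_le hT]
  have hi := integrable_triple ha hT
  have e1 : ∫ p, kernelChain a T p.1 p.2 * kernelChain a T p.2 p.1
      ∂((volume.restrict (Set.Ioc 0 T)).prod (volume.restrict (Set.Ioc 0 T))) =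
      ∫ p : ℝ × ℝ, (∫ t₁ in Set.Ioc 0 T, expKer (t₁ - p.2) *
        (p.1 ^ (a - 1) - powKer a (p.1 - t₁)) * kernelChain a T p.2 p.1)
      ∂((volume.restrict (Set.Ioc 0 T)).prod (volume.restrict (Set.Ioc 0 T))) := by
    congr 1; ext p
    simp only [integral_mul_const, kernelChain, intervalIntegral.integral_of_le hT]
  rw [e1]
  refine Eq.trans (integral_congr_ae ?_) (integral_integral_swap hi)
  filter_upwards [hi.prod_right_ae] with t₁ ht
  exact (integral_prod _ ht).symm

lemma fourfold_integral_eq (ha : 0 < a) (hT : 0 ≤ T) (c : ℝ) :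
    ∫ t1 in (0:ℝ)..T, ∫ t2 in (0:ℝ)..T, ∫ s1 in (0:ℝ)..T, ∫ s2 in (0:ℝ)..T,
        Real.exp (-|t1 - s1| - |t2 - s2|) * Real.sign (t1 - s1) * Real.sign (s2 - t2) *
          (c * (t2 ^ (a - 1) - Real.sign (t2 - t1) * |t2 - t1| ^ (a - 1))) *
          (c * (s1 ^ (a - 1) - Real.sign (s1 - s2) * |s1 - s2| ^ (a - 1))) =
    c ^ 2 * ∫ p, kernelChain a T p.1 p.2 * kernelChain a T p.2 p.1
      ∂((volume.restrict (Set.Ioc 0 T)).prod (volume.restrict (Set.Ioc 0 T))) := by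
  rw [← integral_triple_eq ha hT]
  simp only [kernelChain, ← intervalIntegral.integral_const_mul]
  congr 1; ext t1; congr 1; ext t2; congr 1; ext s1; congr 1; ext s2
  simp only [expKer, powKer]
  rw [sub_eq_add_neg (-|t1 - s1|), exp_add, abs_sub_comm t2 s2]
  ring

end Fubini

section Asymptotics

variable {a T : ℝ}

/-- The weight localising at the two ends of `[0, T]`. -/
noncomputable def endWeight (T v : ℝ) : ℝ := exp (-v) + exp (-(T - v))

/-- A majorant of the boundary profile of `kernelChain`. -/
noncomputable def boundaryProfile (a T u : ℝ) : ℝ :=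
  u ^ (a - 1) + expAvgFuture a u + expAvgFuture a (T - u)

lemma boundaryProfile_nonneg (ha : 0 < a) {u : ℝ} (hu : u ∈ Set.Icc 0 T) :
    0 ≤ boundaryProfile a T u :=
  add_nonneg (add_nonneg (rpow_nonneg hu.1 _) (expAvgFuture_nonneg ha hu.1))
    (expAvgFuture_nonneg ha (by linarith [hu.2]))

lemma endWeight_nonneg (T v : ℝ) : 0 ≤ endWeight T v := by unfold endWeight; positivity

lemma continuous_endWeight (T : ℝ) : Continuous (endWeight T) := by unfold endWeight; fun_prop

lemma abs_kernelChain_add_oddConv_le (ha : 0 < a) {u v : ℝ} (hu : u ∈ Set.Icc 0 T)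
    (hv : v ∈ Set.Icc 0 T) :
    |kernelChain a T u v + oddConv a (|u - v|)| ≤ endWeight T v * boundaryProfile a T u := by
  rw [kernelChain_eq ha hu hv]
  have h1 := rpow_nonneg hu.1 (a - 1)
  have h2 := expAvgFuture_nonneg ha hu.1
  have h3 := expAvgFuture_nonneg ha (x := T - u) (by linarith [hu.2])
  have h4 := exp_pos (-v)
  have h5 := exp_pos (-(T - v))
  have m1 := mul_nonneg h1 h4.le
  have m2 := mul_nonneg h1 h5.le
  have m3 := mul_nonneg h2 h4.le
  have m4 := mul_nonneg h2 h5.le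
  have m5 := mul_nonneg h3 h4.le
  have m6 := mul_nonneg h3 h5.le
  unfold endWeight boundaryProfile
  rw [abs_le]
  constructor <;> nlinarith

lemma abs_kernelChain_mul_sub_le (ha : 0 < a) {M u v : ℝ}
    (hM : ∀ x : ℝ, 0 ≤ x → |oddConv a x| ≤ M) (hu : u ∈ Set.Icc 0 T) (hv : v ∈ Set.Icc 0 T) :
    |kernelChain a T u v * kernelChain a T v u - oddConv a |u - v| ^ 2| ≤
      M * (boundaryProfile a T u * endWeight T v + endWeight T u * boundaryProfile a T v) +
      (endWeight T u * boundaryProfile a T u) * (endWeight T v * boundaryProfile a T v) := by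
  have h1 := abs_kernelChain_add_oddConv_le ha hu hv
  have h2 := abs_kernelChain_add_oddConv_le ha hv hu
  rw [abs_sub_comm v u] at h2
  have h3 := hM _ (abs_nonneg (u - v))
  have hM0 : 0 ≤ M := (abs_nonneg _).trans h3
  set f := oddConv a |u - v|
  set R := kernelChain a T u v + f with hR
  set R' := kernelChain a T v u + f with hR'
  have e : kernelChain a T u v * kernelChain a T v u - f ^ 2 =
      R * R' - f * R - f * R' := by rw [hR, hR']; ring
  have b1 : |R * R'| ≤ (endWeight T v * boundaryProfile a T u) *
      (endWeight T u * boundaryProfile a T v) := by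
    rw [abs_mul]; exact mul_le_mul h1 h2 (abs_nonneg _) ((abs_nonneg _).trans h1)
  have b2 : |f * R| ≤ M * (endWeight T v * boundaryProfile a T u) := by
    rw [abs_mul]; exact mul_le_mul h3 h1 (abs_nonneg _) hM0
  have b3 : |f * R'| ≤ M * (endWeight T u * boundaryProfile a T v) := by
    rw [abs_mul]; exact mul_le_mul h3 h2 (abs_nonneg _) hM0
  rw [e]
  calc |R * R' - f * R - f * R'| ≤ |R * R'| + |f * R| + |f * R'| :=
        (abs_sub _ _).trans (add_le_add (abs_sub _ _) le_rfl)
    _ ≤ _ := by linarith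

lemma intervalIntegrable_boundaryProfile (ha : 0 < a) (T p q : ℝ) :
    IntervalIntegrable (boundaryProfile a T) volume p q := by
  have hc := continuous_expAvgFuture ha
  have h1 : IntervalIntegrable (fun u : ℝ => u ^ (a - 1)) volume p q :=
    intervalIntegral.intervalIntegrable_rpow' (by linarith)
  exact (h1.add (hc.intervalIntegrable _ _)).add
    (Continuous.intervalIntegrable (by fun_prop) _ _)

lemma integral_rpow_sub_one (ha : 0 < a) (T : ℝ) :
    ∫ u in (0:ℝ)..T, u ^ (a - 1) = T ^ a / a := by
  rw [integral_rpow (Or.inl (by linarith))]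
  simp [ha.ne']

lemma integral_expAvgFuture_le (ha : 0 < a) (ha1 : a < 1) (hT : 0 ≤ T) :
    ∫ u in (0:ℝ)..T, expAvgFuture a u ≤ T ^ a / a := by
  rw [← integral_rpow_sub_one ha]
  exact intervalIntegral.integral_mono_on_of_le_Ioo hT
    ((continuous_expAvgFuture ha).intervalIntegrable _ _)
    (intervalIntegral.intervalIntegrable_rpow' (by linarith))
    fun u hu => expAvgFuture_le_rpow ha ha1.le hu.1

lemma integral_boundaryProfile_le (ha : 0 < a) (ha1 : a < 1) (hT : 0 ≤ T) :
    ∫ u in (0:ℝ)..T, boundaryProfile a T u ≤ 3 * (T ^ a / a) := by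
  have hc := continuous_expAvgFuture ha
  have h1 : IntervalIntegrable (fun u : ℝ => u ^ (a - 1)) volume 0 T :=
    intervalIntegral.intervalIntegrable_rpow' (by linarith)
  have h2 := hc.intervalIntegrable (μ := volume) 0 T
  have h3 : IntervalIntegrable (fun u => expAvgFuture a (T - u)) volume 0 T :=
    Continuous.intervalIntegrable (by fun_prop) _ _
  unfold boundaryProfile
  rw [intervalIntegral.integral_add (h1.add h2) h3, intervalIntegral.integral_add h1 h2,
    intervalIntegral.integral_comp_sub_left (fun u => expAvgFuture a u), sub_self, sub_zero,
    integral_rpow_sub_one ha]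
  linarith [integral_expAvgFuture_le ha ha1 hT]

lemma integral_endWeight_le (T : ℝ) : ∫ u in (0:ℝ)..T, endWeight T u ≤ 2 := by
  unfold endWeight
  rw [intervalIntegral.integral_add (Continuous.intervalIntegrable (by fun_prop) _ _)
    (Continuous.intervalIntegrable (by fun_prop) _ _),
    intervalIntegral.integral_comp_sub_left (fun u => exp (-u)), sub_self, sub_zero,
    intervalIntegral.integral_comp_neg (fun u => exp u), integral_exp, neg_zero, exp_zero]
  linarith [exp_pos (-T)]

lemma intervalIntegrable_endWeight_mul_boundaryProfile (ha : 0 < a) (T p q : ℝ) :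
    IntervalIntegrable (fun u => endWeight T u * boundaryProfile a T u) volume p q :=
  (intervalIntegrable_boundaryProfile ha T p q).continuousOn_mul
    (continuous_endWeight T).continuousOn

lemma integral_endWeight_mul_boundaryProfile_le (ha : 0 < a) (ha1 : a < 1) :
    ∃ K, ∀ T : ℝ, 1 ≤ T → ∫ u in (0:ℝ)..T, endWeight T u * boundaryProfile a T u ≤ K := by
  obtain ⟨K, hK, h⟩ := expAvgPast_le_rpow_add ha ha1
  have hG := Gamma_pos_of_pos ha
  refine ⟨Gamma a + (1 + K) + 2 * Gamma a * 2, fun T hT => ?_⟩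
  have hT0 : 0 < T := by linarith
  have hi := intervalIntegrable_exp_neg_mul_rpow ha 0 T
  have hj : IntervalIntegrable (fun u => exp (-T) * (exp u * u ^ (a - 1))) volume 0 T :=
    (intervalIntegrable_exp_mul_rpow ha 0 T).const_mul _
  have hk : IntervalIntegrable (fun u => 2 * Gamma a * endWeight T u) volume 0 T :=
    ((continuous_endWeight T).intervalIntegrable 0 T).const_mul _
  have h1 : ∫ u in (0:ℝ)..T, exp (-u) * u ^ (a - 1) ≤ Gamma a := by
    have := expAvgFuture_nonneg ha hT0.le
    rw [expAvgFuture] at this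
    linarith [nonneg_of_mul_nonneg_right this (exp_pos T)]
  have h2 : ∫ u in (0:ℝ)..T, exp (-T) * (exp u * u ^ (a - 1)) ≤ 1 + K := by
    rw [intervalIntegral.integral_const_mul]
    refine (h T hT).trans (add_le_add ?_ ?_)
    · exact rpow_le_one_of_one_le_of_nonpos hT (by linarith)
    · exact mul_le_of_le_one_right hK (inv_le_one_of_one_le₀ hT)
  have h3 : ∫ u in (0:ℝ)..T, 2 * Gamma a * endWeight T u ≤ 2 * Gamma a * 2 := by
    rw [intervalIntegral.integral_const_mul]
    gcongr
    exact integral_endWeight_le T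
  calc ∫ u in (0:ℝ)..T, endWeight T u * boundaryProfile a T u
      ≤ ∫ u in (0:ℝ)..T, (exp (-u) * u ^ (a - 1) + exp (-T) * (exp u * u ^ (a - 1)) +
          2 * Gamma a * endWeight T u) := by
        refine intervalIntegral.integral_mono_on hT0.le
          (intervalIntegrable_endWeight_mul_boundaryProfile ha T 0 T) ((hi.add hj).add hk)
          fun u hu => ?_
        have g1 := expAvgFuture_le_Gamma ha ha1.le hu.1
        have g2 := expAvgFuture_le_Gamma ha ha1.le (x := T - u) (by linarith [hu.2])
        have e : exp (-(T - u)) = exp (-T) * exp u := by rw [← exp_add]; congr 1; ring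
        calc endWeight T u * boundaryProfile a T u ≤
              endWeight T u * (u ^ (a - 1) + 2 * Gamma a) := by
              refine mul_le_mul_of_nonneg_left ?_ (endWeight_nonneg T u)
              unfold boundaryProfile; linarith
          _ = _ := by
              simp only [endWeight, e]
              ring
    _ ≤ _ := by
        rw [intervalIntegral.integral_add (hi.add hj) hk, intervalIntegral.integral_add hi hj]
        linarith

lemma integral_prod_oddConv_sq (ha : 0 < a) (hT : 0 ≤ T) :
    ∫ p : ℝ × ℝ, oddConv a |p.1 - p.2| ^ 2
      ∂((volume.restrict (Set.Ioc 0 T)).prod (volume.restrict (Set.Ioc 0 T))) =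
    2 * ∫ u in (0:ℝ)..T, ∫ x in (0:ℝ)..u, oddConv a x ^ 2 := by
  have hc := continuous_oddConv ha
  have hc2 : Continuous fun x => oddConv a x ^ 2 := hc.pow 2
  have hint : Integrable (fun p : ℝ × ℝ => oddConv a |p.1 - p.2| ^ 2)
      ((volume.restrict (Set.Ioc 0 T)).prod (volume.restrict (Set.Ioc 0 T))) := by
    rw [Measure.prod_restrict]
    exact ((by fun_prop : Continuous fun p : ℝ × ℝ => oddConv a |p.1 - p.2| ^ 2).continuousOn
      |>.integrableOn_compact (isCompact_Icc.prod isCompact_Icc)).mono_set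
      (Set.prod_mono Set.Ioc_subset_Icc_self Set.Ioc_subset_Icc_self)
  rw [integral_prod _ hint]
  simp only [← intervalIntegral.integral_of_le hT]
  have hS : Continuous fun u => ∫ x in (0:ℝ)..u, oddConv a x ^ 2 :=
    intervalIntegral.continuous_primitive (fun _ _ => hc2.intervalIntegrable _ _) 0
  have e : ∫ u in (0:ℝ)..T, ∫ v in (0:ℝ)..T, oddConv a |u - v| ^ 2 =
      ∫ u in (0:ℝ)..T, ((∫ x in (0:ℝ)..u, oddConv a x ^ 2) +
        ∫ x in (0:ℝ)..(T - u), oddConv a x ^ 2) := by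
    refine intervalIntegral.integral_congr fun u hu => ?_
    rw [Set.uIcc_of_le hT] at hu
    have hcu : Continuous fun v => oddConv a |u - v| ^ 2 := by fun_prop
    rw [← intervalIntegral.integral_add_adjacent_intervals (hcu.intervalIntegrable 0 u)
      (hcu.intervalIntegrable u T)]
    congr 1
    · have := intervalIntegral.integral_comp_sub_left (fun x => oddConv a x ^ 2) u
        (a := 0) (b := u)
      rw [sub_self, sub_zero] at this
      rw [← this]
      refine intervalIntegral.integral_congr_Ioo_of_le hu.1 fun v hv => ?_
      simp only [abs_of_pos (sub_pos.2 hv.2)]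
    · have := intervalIntegral.integral_comp_sub_right (fun x => oddConv a x ^ 2) u
        (a := u) (b := T)
      rw [sub_self] at this
      rw [← this]
      refine intervalIntegral.integral_congr_Ioo_of_le hu.2 fun v hv => ?_
      simp only [abs_sub_comm u v, abs_of_pos (sub_pos.2 hv.1)]
  rw [e, intervalIntegral.integral_add (hS.intervalIntegrable _ _)
    (Continuous.intervalIntegrable (by fun_prop) _ _),
    intervalIntegral.integral_comp_sub_left (fun u => ∫ x in (0:ℝ)..u, oddConv a x ^ 2),
    sub_self, sub_zero]
  ring

lemma abs_integral_prod_oddConv_sq_sub_le (ha : 0 < a) (ha1 : a < 1) :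
    ∃ C, ∀ T : ℝ, 0 ≤ T → |(∫ p : ℝ × ℝ, oddConv a |p.1 - p.2| ^ 2
      ∂((volume.restrict (Set.Ioc 0 T)).prod (volume.restrict (Set.Ioc 0 T)))) -
      2 * T * ∫ x in Set.Ioi (0:ℝ), oddConv a x ^ 2| ≤ C * T ^ a := by
  obtain ⟨C, hC, h⟩ := abs_integral_oddConv_sq_sub_le ha ha1
  refine ⟨2 * (C / a), fun T hT => ?_⟩
  set L := ∫ x in Set.Ioi (0:ℝ), oddConv a x ^ 2
  have hS : Continuous fun u => ∫ x in (0:ℝ)..u, oddConv a x ^ 2 :=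
    intervalIntegral.continuous_primitive
      (fun _ _ => ((continuous_oddConv ha).pow 2).intervalIntegrable _ _) 0
  have e : (2 * ∫ u in (0:ℝ)..T, ∫ x in (0:ℝ)..u, oddConv a x ^ 2) - 2 * T * L =
      2 * ∫ u in (0:ℝ)..T, ((∫ x in (0:ℝ)..u, oddConv a x ^ 2) - L) := by
    rw [intervalIntegral.integral_sub (hS.intervalIntegrable _ _) intervalIntegrable_const,
      intervalIntegral.integral_const, smul_eq_mul]
    ring
  have b : |∫ u in (0:ℝ)..T, ((∫ x in (0:ℝ)..u, oddConv a x ^ 2) - L)| ≤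
      ∫ u in (0:ℝ)..T, C * u ^ (a - 1) := by
    refine intervalIntegral.norm_integral_le_of_norm_le (μ := volume)
      (f := fun u => (∫ x in (0:ℝ)..u, oddConv a x ^ 2) - L) (g := fun u => C * u ^ (a - 1)) hT
      (Eventually.of_forall fun u hu => h u hu.1)
      ((intervalIntegral.intervalIntegrable_rpow' (by linarith)).const_mul C)
  rw [intervalIntegral.integral_const_mul, integral_rpow_sub_one ha] at b
  rw [integral_prod_oddConv_sq ha hT, e, abs_mul, abs_two]
  calc 2 * |∫ u in (0:ℝ)..T, ((∫ x in (0:ℝ)..u, oddConv a x ^ 2) - L)| ≤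
      2 * (C * (T ^ a / a)) := by gcongr
    _ = _ := by ring

lemma abs_integral_kernelChain_mul_sub_le (ha : 0 < a) (ha1 : a < 1) :
    ∃ C, ∀ T : ℝ, 1 ≤ T →
      |(∫ p, kernelChain a T p.1 p.2 * kernelChain a T p.2 p.1
        ∂((volume.restrict (Set.Ioc 0 T)).prod (volume.restrict (Set.Ioc 0 T)))) -
      ∫ p : ℝ × ℝ, oddConv a |p.1 - p.2| ^ 2
        ∂((volume.restrict (Set.Ioc 0 T)).prod (volume.restrict (Set.Ioc 0 T)))| ≤ C * T ^ a := by
  obtain ⟨M, hM0, hM⟩ := abs_oddConv_bounded ha ha1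
  obtain ⟨K, hK⟩ := integral_endWeight_mul_boundaryProfile_le ha ha1
  refine ⟨M * (2 * (3 * a⁻¹ * 2)) + K ^ 2, fun T hT => ?_⟩
  have hT0 : 0 ≤ T := by linarith
  have hTa : 1 ≤ T ^ a := one_le_rpow hT ha.le
  set μ := volume.restrict (Set.Ioc 0 T) with hμ
  have hc := continuous_oddConv ha
  have iP := integrable_kernelChain_mul ha hT0
  have iF : Integrable (fun p : ℝ × ℝ => oddConv a |p.1 - p.2| ^ 2) (μ.prod μ) := by
    rw [hμ, Measure.prod_restrict]
    exact ((by fun_prop : Continuous fun p : ℝ × ℝ => oddConv a |p.1 - p.2| ^ 2).continuousOn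
      |>.integrableOn_compact (isCompact_Icc.prod isCompact_Icc)).mono_set
      (Set.prod_mono Set.Ioc_subset_Icc_self Set.Ioc_subset_Icc_self)
  have iw : Integrable (endWeight T) μ :=
    (intervalIntegrable_iff_integrableOn_Ioc_of_le hT0).1
      ((continuous_endWeight T).intervalIntegrable 0 T)
  have im : Integrable (boundaryProfile a T) μ :=
    (intervalIntegrable_iff_integrableOn_Ioc_of_le hT0).1
      (intervalIntegrable_boundaryProfile ha T 0 T)
  have iwm : Integrable (fun u => endWeight T u * boundaryProfile a T u) μ :=
    (intervalIntegrable_iff_integrableOn_Ioc_of_le hT0).1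
      (intervalIntegrable_endWeight_mul_boundaryProfile ha T 0 T)
  have bw : ∫ u, endWeight T u ∂μ ≤ 2 := by
    rw [hμ, ← intervalIntegral.integral_of_le hT0]; exact integral_endWeight_le T
  have bm : ∫ u, boundaryProfile a T u ∂μ ≤ 3 * (T ^ a / a) := by
    rw [hμ, ← intervalIntegral.integral_of_le hT0]; exact integral_boundaryProfile_le ha ha1 hT0
  have bwm : ∫ u, endWeight T u * boundaryProfile a T u ∂μ ≤ K := by
    rw [hμ, ← intervalIntegral.integral_of_le hT0]; exact hK T hT
  have pw : 0 ≤ ∫ u, endWeight T u ∂μ := integral_nonneg fun u => endWeight_nonneg T u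
  have pm : 0 ≤ ∫ u, boundaryProfile a T u ∂μ :=
    setIntegral_nonneg measurableSet_Ioc fun u hu =>
      boundaryProfile_nonneg ha (Set.Ioc_subset_Icc_self hu)
  have pwm : 0 ≤ ∫ u, endWeight T u * boundaryProfile a T u ∂μ :=
    setIntegral_nonneg measurableSet_Ioc fun u hu => mul_nonneg (endWeight_nonneg T u)
      (boundaryProfile_nonneg ha (Set.Ioc_subset_Icc_self hu))
  have j1 := im.mul_prod iw
  have j2 := iw.mul_prod im
  have j3 := iwm.mul_prod iwm
  rw [← integral_sub iP iF]
  have b := norm_integral_le_of_norm_le (μ := μ.prod μ)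
    (f := fun p : ℝ × ℝ => kernelChain a T p.1 p.2 * kernelChain a T p.2 p.1 -
      oddConv a |p.1 - p.2| ^ 2)
    (((j1.add j2).const_mul M).add j3) (by
      rw [hμ, Measure.prod_restrict]
      filter_upwards [ae_restrict_mem (measurableSet_Ioc.prod measurableSet_Ioc)] with p hp
      exact abs_kernelChain_mul_sub_le ha hM (Set.Ioc_subset_Icc_self hp.1)
        (Set.Ioc_subset_Icc_self hp.2))
  refine b.trans ?_
  rw [integral_add' ((j1.add j2).const_mul M) j3, integral_const_mul, integral_add' j1 j2,
    integral_prod_mul, integral_prod_mul,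
    integral_prod_mul (fun u => endWeight T u * boundaryProfile a T u)
      (fun u => endWeight T u * boundaryProfile a T u)]
  have c1 : (∫ u, boundaryProfile a T u ∂μ) * ∫ u, endWeight T u ∂μ ≤ 3 * (T ^ a / a) * 2 :=
    mul_le_mul bm bw pw (by positivity)
  have c2 : (∫ u, endWeight T u * boundaryProfile a T u ∂μ) *
      ∫ u, endWeight T u * boundaryProfile a T u ∂μ ≤ K * K :=
    mul_le_mul bwm bwm pwm (pwm.trans bwm)
  have c3 : K * K ≤ K ^ 2 * T ^ a := by nlinarith [sq_nonneg K]
  calc _ ≤ M * (3 * (T ^ a / a) * 2 + 3 * (T ^ a / a) * 2) + K ^ 2 * T ^ a := by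
        refine add_le_add (mul_le_mul_of_nonneg_left (add_le_add c1 ?_) hM0) (c2.trans c3)
        rw [mul_comm]; exact c1
    _ = _ := by ring

end Asymptotics

theorem stmt_8 (H : ℝ) (hH : H ∈ Set.Ioo (0:ℝ) (1/2))
    (σsq : ℝ)
    (hσ : σsq = (4 * H - 1) + 2 * Real.Gamma (2 - 4 * H) * Real.Gamma (4 * H) /
        (Real.Gamma (2 * H) * Real.Gamma (1 - 2 * H)))
    (I1 : ℝ → ℝ)
    (hI1 : ∀ T : ℝ, I1 T =
      ∫ t1 in (0:ℝ)..T, ∫ t2 in (0:ℝ)..T, ∫ s1 in (0:ℝ)..T, ∫ s2 in (0:ℝ)..T,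
        Real.exp (-|t1 - s1| - |t2 - s2|) * Real.sign (t1 - s1) * Real.sign (s2 - t2) *
          (H * (t2 ^ (2 * H - 1) - Real.sign (t2 - t1) * |t2 - t1| ^ (2 * H - 1))) *
          (H * (s1 ^ (2 * H - 1) - Real.sign (s1 - s2) * |s1 - s2| ^ (2 * H - 1)))) :
    ∃ C : ℝ, ∀ᶠ T : ℝ in atTop,
      T ^ (1 - 2 * H) * |I1 T / (2 * T) - σsq * (H * Real.Gamma (2 * H)) ^ 2| ≤ C := by
  obtain ⟨hH0, hH1⟩ := hH
  have ha : 0 < 2 * H := by linarith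
  have ha1 : 2 * H < 1 := by linarith
  obtain ⟨C₁, h₁⟩ := abs_integral_kernelChain_mul_sub_le ha ha1
  obtain ⟨C₂, h₂⟩ := abs_integral_prod_oddConv_sq_sub_le ha ha1
  have hL := integral_oddConv_sq ha ha1
  rw [show 2 * (2 * H) - 1 = 4 * H - 1 by ring, show 2 - 2 * (2 * H) = 2 - 4 * H by ring,
    show 2 * (2 * H) = 4 * H by ring, ← hσ] at hL
  refine ⟨H ^ 2 * (C₁ + C₂) / 2, ?_⟩
  filter_upwards [eventually_ge_atTop 1] with T hT
  have hT0 : 0 < T := by linarith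
  have k₁ := h₁ T hT
  have k₂ := h₂ T hT0.le
  rw [hI1, fourfold_integral_eq ha hT0.le H]
  set P := ∫ p, kernelChain (2 * H) T p.1 p.2 * kernelChain (2 * H) T p.2 p.1
      ∂((volume.restrict (Set.Ioc 0 T)).prod (volume.restrict (Set.Ioc 0 T)))
  have e : H ^ 2 * P / (2 * T) - σsq * (H * Gamma (2 * H)) ^ 2 =
      H ^ 2 / (2 * T) * (P - 2 * T * ∫ x in Set.Ioi (0:ℝ), oddConv (2 * H) x ^ 2) := by
    rw [hL]; field_simp
  have k₃ : |P - 2 * T * ∫ x in Set.Ioi (0:ℝ), oddConv (2 * H) x ^ 2| ≤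
      (C₁ + C₂) * T ^ (2 * H) := by
    refine (abs_sub_le _ _ _).trans ((add_le_add k₁ k₂).trans ?_)
    rw [add_mul]
  have ep : T ^ (1 - 2 * H) * T ^ (2 * H) = T := by
    rw [← rpow_add hT0]; simp
  rw [e, abs_mul, abs_of_pos (by positivity)]
  calc T ^ (1 - 2 * H) * (H ^ 2 / (2 * T) *
        |P - 2 * T * ∫ x in Set.Ioi (0:ℝ), oddConv (2 * H) x ^ 2|)
      ≤ T ^ (1 - 2 * H) * (H ^ 2 / (2 * T) * ((C₁ + C₂) * T ^ (2 * H))) := by gcongr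
    _ = H ^ 2 / (2 * T) * (C₁ + C₂) * (T ^ (1 - 2 * H) * T ^ (2 * H)) := by ring
    _ = H ^ 2 * (C₁ + C₂) / 2 := by rw [ep]; field_simp
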